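/- For every ε > 0 there exist δ > 0 and n₀ such that every simple graph G with n ≥ n₀ vertices and λ_{4,3}(G) ≥ 1/2 − δ is within edit distance at most ε·C(n,2) from the complete bipartite graph with parts of sizes ⌊n/2⌋ and ⌈n/2⌉, or within edit distance at most ε·C(n,2) from the vertex-disjoint union of two cliques of sizes ⌊n/2⌋ and ⌈n/2⌉. -/

import Mathlib

open Finset
open scoped Classical

/-- Number of edges of `G` inside the vertex subset `S`. -/
noncomputable def edgeCount {n : ℕ} (G : SimpleGraph (Fin n)) (S : Finset (Fin n)) : ℕ :=
  (Finset.univ.filter (fun p : Fin n × Fin n =>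
    p.1 ∈ S ∧ p.2 ∈ S ∧ p.1 < p.2 ∧ G.Adj p.1 p.2)).card

/-- `Λ_{κ,ℓ}(G)`: number of `κ`-subsets of vertices inducing exactly `ℓ` edges. -/
noncomputable def numKL (κ ℓ : ℕ) {n : ℕ} (G : SimpleGraph (Fin n)) : ℕ :=
  ((Finset.powersetCard κ Finset.univ).filter (fun S => edgeCount G S = ℓ)).card

/-- `λ_{κ,ℓ}(G) = Λ_{κ,ℓ}(G) / C(n,κ)`. -/
noncomputable def lamKL (κ ℓ : ℕ) {n : ℕ} (G : SimpleGraph (Fin n)) : ℝ :=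
  (numKL κ ℓ G : ℝ) / (n.choose κ : ℝ)

/-- `λ_{κ,ℓ}(n)`: the maximum of `λ_{κ,ℓ}(G)` over all graphs on `n` vertices. -/
noncomputable def lamKLmax (κ ℓ n : ℕ) : ℝ :=
  ⨆ G : SimpleGraph (Fin n), lamKL κ ℓ G

/-- Edit distance between two graphs on `Fin n`: the minimum over bijections of the number
of vertex pairs whose adjacency must be changed in `G` to obtain a graph isomorphic to `H`. -/
noncomputable def editDist {n : ℕ} (G H : SimpleGraph (Fin n)) : ℕ :=
  ⨅ σ : Equiv.Perm (Fin n),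
    (Finset.univ.filter (fun p : Fin n × Fin n =>
      p.1 < p.2 ∧ ¬ (G.Adj p.1 p.2 ↔ H.Adj (σ p.1) (σ p.2)))).card

/-- Edit distance of `G` to the family of `n`-vertex graphs satisfying `P`. -/
noncomputable def distToFam {n : ℕ} (G : SimpleGraph (Fin n))
    (P : SimpleGraph (Fin n) → Prop) : ℕ :=
  ⨅ H : {H : SimpleGraph (Fin n) // P H}, editDist G H.1

/-- The complete bipartite graph on `Fin n` with parts of sizes `⌊n/2⌋` and `⌈n/2⌉`. -/
def halfBipartite (n : ℕ) : SimpleGraph (Fin n) :=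
  SimpleGraph.fromRel (fun u v => ¬ ((u.val < n/2) ↔ (v.val < n/2)))

/-- The disjoint union of two cliques on `Fin n`, of sizes `⌊n/2⌋` and `⌈n/2⌉`. -/
def halfTwoCliques (n : ℕ) : SimpleGraph (Fin n) :=
  SimpleGraph.fromRel (fun u v => (u.val < n/2) ↔ (v.val < n/2))


/-- Multilinear polynomials in sign variables: `lf p m` is the constant `p - m`,
`nd l r` is `l + x * r` for the variable of the current level. -/
inductive MT : Type
  | z : MT
  | lf : ℕ → ℕ → MT
  | nd : MT → MT → MT

namespace MT

def ev (x : ℕ → ℤ) : MT → ℕ → ℤ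
  | z, _ => 0
  | lf p m, _ => (p : ℤ) - m
  | nd l r, k => ev x l (k+1) + x k * ev x r (k+1)

/-- Add a constant. (Recursors are used directly so that kernel reduction is fast.) -/
noncomputable def addC (p m : ℕ) (t : MT) : MT :=
  MT.rec (motive := fun _ => MT) (lf p m) (fun p' m' => lf (Nat.add p p') (Nat.add m m'))
    (fun _ r hl _ => nd hl r) t

noncomputable def add (s : MT) : MT → MT :=
  MT.rec (motive := fun _ => MT → MT) (fun b => b) (fun p m b => addC p m b)
    (fun l r hl hr b => MT.rec (motive := fun _ => MT) (nd l r) (fun p m => addC p m (nd l r))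
      (fun l' r' _ _ => nd (hl l') (hr r')) b) s

noncomputable def neg (s : MT) : MT :=
  MT.rec (motive := fun _ => MT) z (fun p m => lf m p) (fun _ _ hl hr => nd hl hr) s

/-- Subtraction. -/
noncomputable def sub (s : MT) : MT → MT :=
  MT.rec (motive := fun _ => MT → MT) (fun b => neg b) (fun p m b => addC p m (neg b))
    (fun l r hl hr b => MT.rec (motive := fun _ => MT) (nd l r) (fun p m => addC m p (nd l r))
      (fun l' r' _ _ => nd (hl l') (hr r')) b) s

noncomputable def mulC (p m : ℕ) (s : MT) : MT :=
  MT.rec (motive := fun _ => MT) z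
    (fun p' m' => lf (Nat.add (Nat.mul p p') (Nat.mul m m')) (Nat.add (Nat.mul p m') (Nat.mul m p')))
    (fun _ _ hl hr => nd hl hr) s

noncomputable def mul (s : MT) : MT → MT :=
  MT.rec (motive := fun _ => MT → MT) (fun _ => z) (fun p m b => mulC p m b)
    (fun l r hl hr b => MT.rec (motive := fun _ => MT) z (fun p m => mulC p m (nd l r))
      (fun l' r' _ _ => nd (add (hl l') (hr r')) (add (hl r') (hr l'))) b) s

noncomputable def var (k : ℕ) : MT :=
  Nat.rec (motive := fun _ => MT) (nd z (lf 1 0)) (fun _ h => nd h z) k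

/-- Nonnegativity check on all sign vectors. -/
noncomputable def nn (k : ℕ) : MT → Bool :=
  Nat.rec (motive := fun _ => MT → Bool)
    (fun t => MT.rec (motive := fun _ => Bool) true (fun p m => Nat.ble m p) (fun _ _ _ _ => false) t)
    (fun _ h t => MT.rec (motive := fun _ => Bool) true (fun p m => Nat.ble m p)
      (fun l r _ _ => Bool.rec false (h (sub l r)) (h (add l r))) t) k

theorem ev_addC (x : ℕ → ℤ) (p m : ℕ) (t : MT) (k : ℕ) :
    ev x (addC p m t) k = (p : ℤ) - m + ev x t k := by
  induction t generalizing k with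
  | z => simp [addC, ev]
  | lf a b => simp [addC, ev]; ring
  | nd l r hl hr =>
    change ev x (nd (addC p m l) r) k = _
    simp only [ev, hl]; ring

theorem ev_add (x : ℕ → ℤ) (s t : MT) (k : ℕ) :
    ev x (add s t) k = ev x s k + ev x t k := by
  induction s generalizing t k with
  | z => simp [add, ev]
  | lf a b => simp [add, ev, ev_addC]
  | nd l r hl hr =>
    cases t with
    | z => simp [add, ev]
    | lf a b => simp [add, ev, ev_addC]; ring
    | nd l' r' =>
      change ev x (nd (add l l') (add r r')) k = _
      simp only [ev, hl, hr]; ring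

theorem ev_neg (x : ℕ → ℤ) (s : MT) (k : ℕ) : ev x (neg s) k = - ev x s k := by
  induction s generalizing k with
  | z => simp [neg, ev]
  | lf a b => simp [neg, ev]
  | nd l r hl hr =>
    change ev x (nd (neg l) (neg r)) k = _
    simp only [ev, hl, hr]; ring

theorem ev_sub (x : ℕ → ℤ) (s t : MT) (k : ℕ) :
    ev x (sub s t) k = ev x s k - ev x t k := by
  induction s generalizing t k with
  | z => simp [sub, ev, ev_neg]
  | lf a b => simp [sub, ev, ev_addC, ev_neg]; ring
  | nd l r hl hr =>
    cases t with
    | z => simp [sub, ev]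
    | lf a b => simp only [sub, ev, ev_addC]; ring
    | nd l' r' =>
      change ev x (nd (sub l l') (sub r r')) k = _
      simp only [ev, hl, hr]; ring

theorem ev_mulC (x : ℕ → ℤ) (p m : ℕ) (t : MT) (k : ℕ) :
    ev x (mulC p m t) k = ((p : ℤ) - m) * ev x t k := by
  induction t generalizing k with
  | z => simp [mulC, ev]
  | lf a b => simp [mulC, ev]; ring
  | nd l r hl hr =>
    change ev x (nd (mulC p m l) (mulC p m r)) k = _
    simp only [ev, hl, hr]; ring

theorem ev_mul (x : ℕ → ℤ) (hx : ∀ i, x i * x i = 1) (s t : MT) (k : ℕ) :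
    ev x (mul s t) k = ev x s k * ev x t k := by
  induction s generalizing t k with
  | z => simp [mul, ev]
  | lf a b => simp [mul, ev, ev_mulC]
  | nd l r hl hr =>
    cases t with
    | z => simp [mul, ev]
    | lf a b => simp [mul, ev, ev_mulC]; ring
    | nd l' r' =>
      change ev x (nd (add (mul l l') (mul r r')) (add (mul l r') (mul r l'))) k = _
      simp only [ev, ev_add, hl, hr]
      linear_combination (-(ev x r (k+1)) * ev x r' (k+1)) * hx k

theorem ev_var (x : ℕ → ℤ) (i k : ℕ) : ev x (var i) k = x (k + i) := by
  induction i generalizing k with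
  | zero => simp [var, ev]
  | succ i ih =>
    change ev x (nd (var i) z) k = _
    simp only [ev, ih]; rw [mul_zero, add_zero]; congr 1; omega

theorem ev_nonneg (x : ℕ → ℤ) (hx : ∀ i, x i = 1 ∨ x i = -1) (d : ℕ) (t : MT) (k : ℕ)
    (h : nn d t = true) : 0 ≤ ev x t k := by
  induction d generalizing t k with
  | zero => cases t with
    | z => simp [ev]
    | lf p m => simp [nn] at h; simp [ev]; exact h
    | nd l r => simp [nn] at h
  | succ d ih => cases t with
    | z => simp [ev]
    | lf p m => simp [nn] at h; simp [ev]; exact h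
    | nd l r =>
      have h' : nn d (add l r) = true ∧ nn d (sub l r) = true := by
        change (Bool.rec false (nn d (sub l r)) (nn d (add l r)) : Bool) = true at h
        cases hq : nn d (add l r) with
        | false => rw [hq] at h; exact absurd h (by simp)
        | true => rw [hq] at h; exact ⟨rfl, h⟩
      have h1 := ih _ (k+1) h'.1
      have h2 := ih _ (k+1) h'.2
      rw [ev_add] at h1
      rw [ev_sub] at h2
      rcases hx k with h | h <;> simp only [ev, h] <;> linarith

noncomputable instance : Add MT := ⟨add⟩
noncomputable instance : Mul MT := ⟨mul⟩
noncomputable instance : Neg MT := ⟨neg⟩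
noncomputable instance : Sub MT := ⟨sub⟩
end MT

/-- even block of certificate -/
def gV {α : Type} [Add α] [Sub α] [Mul α] [Neg α] (one : α) (e a b a' b' c : α) : Fin 5 → α :=
  ![a * a' + b * b', a * b * (a' * b') - one, e * c, (c - e) * (a + a' + (b + b')),
    e * c * (a * b * (a' * b'))]

def hV {α : Type} [Add α] [Sub α] [Mul α] [Neg α] (e a b a' b' c : α) : Fin 4 → α :=
  ![e * (a + a' - (b + b')) + e * (a * a' * (b + b') - b * b' * (a + a')),
    (e + c) * (a + a' - (b + b')), e * c * (a * a' - b * b'),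
    c * (a * a' * (b + b') - b * b' * (a + a')) - e * (a + a' - (b + b'))]

def bil {α : Type} [Add α] [Sub α] [Mul α] [Neg α] (κ : ℕ → α) (g g' : Fin 5 → α)
    (h h' : Fin 4 → α) : α :=
  (g 0 * (κ 20 * g' 0 - κ 20 * g' 3) + g 3 * (κ 48 * g' 3 - κ 20 * g' 0)) +
  (g 1 * (κ 40 * g' 1 + κ 56 * g' 2 - κ 96 * g' 4)
    + (g 2 * (κ 56 * g' 1 + κ 1244 * g' 2 - κ 148 * g' 4)
    + g 4 * (κ 252 * g' 4 - κ 96 * g' 1 - κ 148 * g' 2))) +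
  ((h 0 * (κ 24 * h' 0 - κ 24 * h' 1 - κ 12 * h' 2 - κ 16 * h' 3)
    + h 1 * (κ 129 * h' 1 - κ 24 * h' 0 - κ 56 * h' 2 - κ 8 * h' 3))
    + (h 2 * (κ 52 * h' 2 + κ 24 * h' 3 - κ 12 * h' 0 - κ 56 * h' 1)
    + h 3 * (κ 20 * h' 3 + κ 24 * h' 2 - κ 16 * h' 0 - κ 8 * h' 1)))

def f16 {α : Type} [Add α] [Sub α] [Mul α] [Neg α] (κ : ℕ → α) (a b c d e f : α) : α :=
  κ 5 - (a*b + (a+b)*c + (a+b+c)*d + (a+b+c+d)*e + (a+b+c+d+e)*f)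
   + (a*b*(c*d+c*e+c*f+d*e+d*f+e*f) + (a+b)*(c*d*(e+f)+e*f*(c+d)) + c*d*(e*f))
   - κ 5 * (a*b*(c*d)*(e*f))

def Rg {α : Type} [Add α] [Sub α] [Mul α] [Neg α] (κ : ℕ → α) (x : Fin 6 → Fin 6 → α)
   (u v w z w' z' : Fin 6) : α :=
  κ 1280 - κ 160 * f16 κ (x w z) (x w w') (x w z') (x z w') (x z z') (x w' z') -
   bil κ (gV (κ 1) (x u v) (x u w) (x v w) (x u z) (x v z) (x w z))
     (gV (κ 1) (x u v) (x u w') (x v w') (x u z') (x v z') (x w' z'))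
     (hV (x u v) (x u w) (x v w) (x u z) (x v z) (x w z))
     (hV (x u v) (x u w') (x v w') (x u z') (x v z') (x w' z'))
def L45 : List (Fin 6 × Fin 6 × Fin 6 × Fin 6 × Fin 6 × Fin 6) :=
  [(0,1,2,3,4,5), (0,1,2,4,3,5), (0,1,2,5,3,4), (0,2,1,3,4,5), (0,2,1,4,3,5),
   (0,2,1,5,3,4), (0,3,1,2,4,5), (0,3,1,4,2,5), (0,3,1,5,2,4), (0,4,1,2,3,5),
   (0,4,1,3,2,5), (0,4,1,5,2,3), (0,5,1,2,3,4), (0,5,1,3,2,4), (0,5,1,4,2,3),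
   (1,2,0,3,4,5), (1,2,0,4,3,5), (1,2,0,5,3,4), (1,3,0,2,4,5), (1,3,0,4,2,5),
   (1,3,0,5,2,4), (1,4,0,2,3,5), (1,4,0,3,2,5), (1,4,0,5,2,3), (1,5,0,2,3,4),
   (1,5,0,3,2,4), (1,5,0,4,2,3), (2,3,0,1,4,5), (2,3,0,4,1,5), (2,3,0,5,1,4),
   (2,4,0,1,3,5), (2,4,0,3,1,5), (2,4,0,5,1,3), (2,5,0,1,3,4), (2,5,0,3,1,4),
   (2,5,0,4,1,3), (3,4,0,1,2,5), (3,4,0,2,1,5), (3,4,0,5,1,2), (3,5,0,1,2,4),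
   (3,5,0,2,1,4), (3,5,0,4,1,2), (4,5,0,1,2,3), (4,5,0,2,1,3), (4,5,0,3,1,2)]

def eIdx : Fin 6 → Fin 6 → ℕ :=
  ![![0, 0, 1, 2, 3, 4], ![0, 0, 5, 6, 7, 8], ![1, 5, 0, 9, 10, 11],
    ![2, 6, 9, 0, 12, 13], ![3, 7, 10, 12, 0, 14], ![4, 8, 11, 13, 14, 0]]

noncomputable def RT (p : Fin 6 × Fin 6 × Fin 6 × Fin 6 × Fin 6 × Fin 6) : MT :=
  Rg (fun k => MT.lf k 0) (fun i j => MT.var (eIdx i j)) p.1 p.2.1 p.2.2.1 p.2.2.2.1 p.2.2.2.2.1 p.2.2.2.2.2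

noncomputable def slackT : MT := (L45.map RT).foldr MT.add MT.z


theorem slack_nn : MT.nn 15 slackT = true := by decide +kernel

abbrev P6 (α : Type) := α × α × α × α × α × α

def RZ (x : Fin 6 → Fin 6 → ℤ) (p : P6 (Fin 6)) : ℤ :=
  Rg (fun k => (k : ℤ)) x p.1 p.2.1 p.2.2.1 p.2.2.2.1 p.2.2.2.2.1 p.2.2.2.2.2

def okP (p : P6 (Fin 6)) : Bool :=
  p.1 != p.2.1 && p.1 != p.2.2.1 && p.1 != p.2.2.2.1 && p.1 != p.2.2.2.2.1 && p.1 != p.2.2.2.2.2 &&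
    p.2.1 != p.2.2.1 && p.2.1 != p.2.2.2.1 && p.2.1 != p.2.2.2.2.1 && p.2.1 != p.2.2.2.2.2 &&
    p.2.2.1 != p.2.2.2.1 && p.2.2.1 != p.2.2.2.2.1 && p.2.2.1 != p.2.2.2.2.2 && p.2.2.2.1 != p.2.2.2.2.1 && p.2.2.2.1 != p.2.2.2.2.2 && p.2.2.2.2.1 != p.2.2.2.2.2

theorem L45_distinct (p : P6 (Fin 6)) (hp : p ∈ L45) :
    p.1 ≠ p.2.1 ∧ p.1 ≠ p.2.2.1 ∧ p.1 ≠ p.2.2.2.1 ∧ p.1 ≠ p.2.2.2.2.1 ∧ p.1 ≠ p.2.2.2.2.2 ∧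
    p.2.1 ≠ p.2.2.1 ∧ p.2.1 ≠ p.2.2.2.1 ∧ p.2.1 ≠ p.2.2.2.2.1 ∧ p.2.1 ≠ p.2.2.2.2.2 ∧
    p.2.2.1 ≠ p.2.2.2.1 ∧ p.2.2.1 ≠ p.2.2.2.2.1 ∧ p.2.2.1 ≠ p.2.2.2.2.2 ∧ p.2.2.2.1 ≠ p.2.2.2.2.1 ∧ p.2.2.2.1 ≠ p.2.2.2.2.2 ∧ p.2.2.2.2.1 ≠ p.2.2.2.2.2 := by
  have h : L45.all okP = true := by decide +kernel
  have := List.all_eq_true.1 h p hp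
  simp only [okP, Bool.and_eq_true, bne_iff_ne, and_assoc] at this
  exact this

theorem MT.ev_foldr (y : ℕ → ℤ) (f : P6 (Fin 6) → MT) (L : List (P6 (Fin 6))) :
    MT.ev y ((L.map f).foldr MT.add MT.z) 0 = (L.map (fun p => MT.ev y (f p) 0)).sum := by
  induction L with
  | nil => simp [MT.ev]
  | cons a L ih => simp [MT.ev_add, ih]

theorem ev_RT (y : ℕ → ℤ) (hy : ∀ i, y i * y i = 1) (p : P6 (Fin 6)) :
    MT.ev y (RT p) 0 = RZ (fun i j => y (eIdx i j)) p := by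
  have hadd : ∀ s t : MT, MT.ev y (s + t) 0 = MT.ev y s 0 + MT.ev y t 0 :=
    fun s t => MT.ev_add y s t 0
  have hsub : ∀ s t : MT, MT.ev y (s - t) 0 = MT.ev y s 0 - MT.ev y t 0 :=
    fun s t => MT.ev_sub y s t 0
  have hmul : ∀ s t : MT, MT.ev y (s * t) 0 = MT.ev y s 0 * MT.ev y t 0 :=
    fun s t => MT.ev_mul y hy s t 0
  have hc : ∀ k : ℕ, MT.ev y (MT.lf k 0) 0 = (k : ℤ) := by intro k; simp [MT.ev]
  have hv : ∀ i, MT.ev y (MT.var i) 0 = y i := by intro i; simp [MT.ev_var]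
  simp only [RT, RZ, Rg, bil, f16, gV, hV, Matrix.cons_val, hadd, hsub, hmul, hc, hv]

theorem slack_point (x : Fin 6 → Fin 6 → ℤ) (hx : ∀ i j, x i j = 1 ∨ x i j = -1)
    (hs : ∀ i j, x i j = x j i) : 0 ≤ (L45.map (RZ x)).sum := by
  let y : ℕ → ℤ := fun k => match k with
    | 0 => x 0 1 | 1 => x 0 2 | 2 => x 0 3 | 3 => x 0 4 | 4 => x 0 5
    | 5 => x 1 2 | 6 => x 1 3 | 7 => x 1 4 | 8 => x 1 5
    | 9 => x 2 3 | 10 => x 2 4 | 11 => x 2 5 | 12 => x 3 4 | 13 => x 3 5 | 14 => x 4 5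
    | _ => 1
  have hy : ∀ i, y i = 1 ∨ y i = -1 := by
    intro i
    simp only [y]
    split <;> first | exact hx _ _ | exact Or.inl rfl
  have hy2 : ∀ i, y i * y i = 1 := by
    intro i; rcases hy i with h | h <;> rw [h] <;> norm_num
  have h := MT.ev_nonneg y hy 15 slackT 0 slack_nn
  rw [slackT, MT.ev_foldr] at h
  have hoff : ∀ i j : Fin 6, i ≠ j → y (eIdx i j) = x i j := by
    intro i j hij
    fin_cases i <;> fin_cases j <;> first | exact absurd rfl hij | rfl | exact hs _ _
  have key : ∀ p ∈ L45, MT.ev y (RT p) 0 = RZ x p := by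
    intro p hp
    rw [ev_RT y hy2 p]
    obtain ⟨h1, h2, h3, h4, h5, h6, h7, h8, h9, h10, h11, h12, h13, h14, h15⟩ := L45_distinct p hp
    simp only [RZ, Rg, hoff _ _ h1, hoff _ _ h2, hoff _ _ h3, hoff _ _ h4, hoff _ _ h5,
      hoff _ _ h6, hoff _ _ h7, hoff _ _ h8, hoff _ _ h9, hoff _ _ h10, hoff _ _ h11,
      hoff _ _ h12, hoff _ _ h13, hoff _ _ h14, hoff _ _ h15]
  rw [List.map_congr_left key] at h
  exact h

theorem sum_permute {V : Type} [Fintype V] (X : V → V → ℤ) (p : P6 (Fin 6)) (hp : p ∈ L45) :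
    ∑ φ : Fin 6 → V, RZ (fun i j => X (φ i) (φ j)) p =
      ∑ φ : Fin 6 → V, RZ (fun i j => X (φ i) (φ j)) (0, 1, 2, 3, 4, 5) := by
  have hinj : Function.Injective
      ![p.1, p.2.1, p.2.2.1, p.2.2.2.1, p.2.2.2.2.1, p.2.2.2.2.2] := by
    obtain ⟨h1, h2, h3, h4, h5, h6, h7, h8, h9, h10, h11, h12, h13, h14, h15⟩ :=
      L45_distinct p hp
    intro i j hij
    fin_cases i <;> fin_cases j <;> first | rfl | (exfalso; first
      | exact h1 hij | exact h2 hij | exact h3 hij | exact h4 hij | exact h5 hij | exact h6 hij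
      | exact h7 hij | exact h8 hij | exact h9 hij | exact h10 hij | exact h11 hij
      | exact h12 hij | exact h13 hij | exact h14 hij | exact h15 hij
      | exact h1 hij.symm | exact h2 hij.symm | exact h3 hij.symm | exact h4 hij.symm
      | exact h5 hij.symm | exact h6 hij.symm | exact h7 hij.symm | exact h8 hij.symm
      | exact h9 hij.symm | exact h10 hij.symm | exact h11 hij.symm | exact h12 hij.symm
      | exact h13 hij.symm | exact h14 hij.symm | exact h15 hij.symm)
  let π : Equiv.Perm (Fin 6) := Equiv.ofBijective _
    ((Finite.injective_iff_bijective).1 hinj)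
  rw [← Equiv.sum_comp (Equiv.arrowCongr π.symm (Equiv.refl V))
    (fun φ => RZ (fun i j => X (φ i) (φ j)) (0, 1, 2, 3, 4, 5))]
  rfl

theorem sum_Rnonneg {V : Type} [Fintype V] (X : V → V → ℤ) (hx : ∀ i j, X i j = 1 ∨ X i j = -1)
    (hs : ∀ i j, X i j = X j i) :
    0 ≤ ∑ φ : Fin 6 → V, RZ (fun i j => X (φ i) (φ j)) (0, 1, 2, 3, 4, 5) := by
  have h : 0 ≤ ∑ φ : Fin 6 → V, (L45.map (RZ (fun i j => X (φ i) (φ j)))).sum :=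
    Finset.sum_nonneg (fun φ _ => slack_point _ (fun i j => hx _ _) (fun i j => hs _ _))
  have h2 : ∀ L : List (P6 (Fin 6)), (∀ p ∈ L, p ∈ L45) →
      ∑ φ : Fin 6 → V, (L.map (RZ (fun i j => X (φ i) (φ j)))).sum =
      L.length * ∑ φ : Fin 6 → V, RZ (fun i j => X (φ i) (φ j)) (0, 1, 2, 3, 4, 5) := by
    intro L
    induction L with
    | nil => intro _; simp
    | cons a L ih =>
      intro hL
      simp only [List.map_cons, List.sum_cons, Finset.sum_add_distrib]
      rw [ih (fun p hp => hL p (List.mem_cons_of_mem _ hp)),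
        sum_permute X a (hL a List.mem_cons_self)]
      simp only [List.length_cons]; push_cast; ring
  rw [h2 L45 (fun p hp => hp)] at h
  have : (0 : ℤ) < (L45.length : ℤ) := by decide
  exact nonneg_of_mul_nonneg_right h this

def tupEquiv (V : Type) : (V × V) × (V × V) × (V × V) ≃ (Fin 6 → V) where
  toFun t := ![t.1.1, t.1.2, t.2.1.1, t.2.1.2, t.2.2.1, t.2.2.2]
  invFun φ := ((φ 0, φ 1), (φ 2, φ 3), (φ 4, φ 5))
  left_inv t := rfl
  right_inv φ := by ext i; fin_cases i <;> rfl

theorem bil_sum_right {ι : Type} (s : Finset ι) (g : Fin 5 → ℤ) (h : Fin 4 → ℤ)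
    (g' : ι → Fin 5 → ℤ) (h' : ι → Fin 4 → ℤ) :
    ∑ q ∈ s, bil (fun k => (k : ℤ)) g (g' q) h (h' q) =
      bil (fun k => (k : ℤ)) g (fun i => ∑ q ∈ s, g' q i) h (fun i => ∑ q ∈ s, h' q i) := by
  induction s using Finset.induction_on with
  | empty => simp [bil]
  | insert a s ha ih =>
    simp only [Finset.sum_insert ha, ih]
    simp only [bil]; ring

theorem bil_sum_left {ι : Type} (s : Finset ι) (g : Fin 5 → ℤ) (h : Fin 4 → ℤ)
    (g' : ι → Fin 5 → ℤ) (h' : ι → Fin 4 → ℤ) :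
    ∑ q ∈ s, bil (fun k => (k : ℤ)) (g' q) g (h' q) h =
      bil (fun k => (k : ℤ)) (fun i => ∑ q ∈ s, g' q i) g (fun i => ∑ q ∈ s, h' q i) h := by
  induction s using Finset.induction_on with
  | empty => simp [bil]
  | insert a s ha ih =>
    simp only [Finset.sum_insert ha, ih]
    simp only [bil]; ring

theorem bil_pos (g : Fin 5 → ℤ) (h : Fin 4 → ℤ) :
    3 * (g 1)^2 ≤ bil (fun k => (k : ℤ)) g g h h := by
  simp only [bil]
  generalize g 0 = a
  generalize g 1 = b
  generalize g 2 = c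
  generalize g 3 = d
  generalize g 4 = e
  generalize h 0 = p
  generalize h 1 = q
  generalize h 2 = r
  generalize h 3 = s
  have h1 : 3 * b^2 ≤ 40*b*b + 112*b*c - 192*b*e + 1244*c*c - 296*c*e + 252*e*e := by
    nlinarith [sq_nonneg (311*c + 14*b - 37*e), sq_nonneg (9112*e - 3473*b), sq_nonneg b]
  have h2 : 0 ≤ 24*p*p - 48*p*q - 24*p*r - 32*p*s + 129*q*q - 112*q*r - 16*q*s + 52*r*r
      + 48*r*s + 20*s*s := by
    nlinarith [sq_nonneg (6*p - 6*q - 3*r - 4*s), sq_nonneg (105*q - 68*r - 24*s),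
      sq_nonneg (103*r + 24*s), sq_nonneg s]
  have h3 : 0 ≤ 20*a*a - 40*a*d + 48*d*d := by
    nlinarith [sq_nonneg (a - d), sq_nonneg d]
  push_cast
  linarith

/-- quadruple sum of `f16`. -/
def F16 {V : Type} [Fintype V] (X : V → V → ℤ) : ℤ :=
  ∑ p : V × V, ∑ q : V × V, f16 (fun k => (k : ℤ)) (X p.1 p.2) (X p.1 q.1) (X p.1 q.2)
    (X p.2 q.1) (X p.2 q.2) (X q.1 q.2)

def C4d {V : Type} (X : V → V → ℤ) (u v w z : V) : ℤ := 1 - X u w * X v w * (X u z * X v z)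

theorem main_ineq {V : Type} [Fintype V] (X : V → V → ℤ) (hx : ∀ i j, X i j = 1 ∨ X i j = -1)
    (hs : ∀ i j, X i j = X j i) :
    3 * ∑ t : V × V, (∑ p : V × V, C4d X t.1 t.2 p.1 p.2)^2 + 160 * (Fintype.card V : ℤ)^2 * F16 X
      ≤ 1280 * (Fintype.card V : ℤ)^6 := by
  have h := sum_Rnonneg X hx hs
  rw [← Equiv.sum_comp (tupEquiv V)] at h
  rw [Fintype.sum_prod_type] at h
  simp only [Fintype.sum_prod_type (α₁ := V × V) (α₂ := V × V)] at h
  let g : V × V → V × V → Fin 5 → ℤ := fun t p =>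
    gV 1 (X t.1 t.2) (X t.1 p.1) (X t.2 p.1) (X t.1 p.2) (X t.2 p.2) (X p.1 p.2)
  let k : V × V → V × V → Fin 4 → ℤ := fun t p =>
    hV (X t.1 t.2) (X t.1 p.1) (X t.2 p.1) (X t.1 p.2) (X t.2 p.2) (X p.1 p.2)
  have e : ∀ t p q : V × V, RZ (fun i j => X (tupEquiv V (t, p, q) i) (tupEquiv V (t, p, q) j))
      (0, 1, 2, 3, 4, 5) = 1280 - 160 * f16 (fun k => (k : ℤ)) (X p.1 p.2) (X p.1 q.1) (X p.1 q.2)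
    (X p.2 q.1) (X p.2 q.2) (X q.1 q.2) - bil (fun k => (k : ℤ)) (g t p) (g t q) (k t p) (k t q) := by
    intro t p q
    rfl
  simp only [e, Finset.sum_sub_distrib, bil_sum_right, bil_sum_left, ← Finset.mul_sum] at h
  have hF : ∑ p : V × V, ∑ q : V × V, f16 (fun k => (k : ℤ)) (X p.1 p.2) (X p.1 q.1) (X p.1 q.2)
    (X p.2 q.1) (X p.2 q.2) (X q.1 q.2) = F16 X := rfl
  simp only [hF, Finset.sum_const, Finset.card_univ, Fintype.card_prod, nsmul_eq_mul] at h
  have h3 : ∑ t : V × V, 3 * (∑ p : V × V, C4d X t.1 t.2 p.1 p.2)^2 ≤ ∑ t : V × V,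
      bil (fun k => (k : ℤ)) (fun i => ∑ p, g t p i) (fun i => ∑ p, g t p i)
        (fun i => ∑ p, k t p i) (fun i => ∑ p, k t p i) := by
    apply Finset.sum_le_sum
    intro t _
    refine le_trans (le_of_eq ?_) (bil_pos _ _)
    congr 1
    have : ∑ p : V × V, C4d X t.1 t.2 p.1 p.2 = - ∑ p, g t p 1 := by
      rw [← Finset.sum_neg_distrib]
      apply Finset.sum_congr rfl
      intro p _
      simp [C4d, g, gV]
    rw [this, neg_sq]
  rw [← Finset.mul_sum] at h3
  push_cast at h
  nlinarith [h, h3]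

theorem f16_values (a b c d e f : ℤ) (ha : a = 1 ∨ a = -1) (hb : b = 1 ∨ b = -1)
    (hc : c = 1 ∨ c = -1) (hd : d = 1 ∨ d = -1) (he : e = 1 ∨ e = -1) (hf : f = 1 ∨ f = -1) :
    0 ≤ f16 (fun k => (k : ℤ)) a b c d e f ∧ f16 (fun k => (k : ℤ)) a b c d e f ≤ 16 ∧
    (a + b + c + d + e + f = 0 → f16 (fun k => (k : ℤ)) a b c d e f = 16) := by
  rcases ha with rfl | rfl <;> rcases hb with rfl | rfl <;> rcases hc with rfl | rfl <;>
    rcases hd with rfl | rfl <;> rcases he with rfl | rfl <;> rcases hf with rfl | rfl <;>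
    norm_num [f16]

theorem f16_rank_one (τ s₁ s₂ s₃ s₄ : ℤ) (h0 : τ = 1 ∨ τ = -1) (h1 : s₁ = 1 ∨ s₁ = -1)
    (h2 : s₂ = 1 ∨ s₂ = -1) (h3 : s₃ = 1 ∨ s₃ = -1) (h4 : s₄ = 1 ∨ s₄ = -1) :
    f16 (fun k => (k : ℤ)) (τ * s₁ * s₂) (τ * s₁ * s₃) (τ * s₁ * s₄) (τ * s₂ * s₃) (τ * s₂ * s₄)
      (τ * s₃ * s₄) = 8 - 8 * (s₁ * s₂ * (s₃ * s₄)) := by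
  rcases h0 with rfl | rfl <;> rcases h1 with rfl | rfl <;> rcases h2 with rfl | rfl <;>
    rcases h3 with rfl | rfl <;> rcases h4 with rfl | rfl <;> norm_num [f16]

theorem pm_mul {a b : ℤ} (ha : a = 1 ∨ a = -1) (hb : b = 1 ∨ b = -1) : a * b = 1 ∨ a * b = -1 := by
  rcases ha with rfl | rfl <;> rcases hb with rfl | rfl <;> norm_num

theorem pm_dev {a b : ℤ} (ha : a = 1 ∨ a = -1) (hb : b = 1 ∨ b = -1) :
    (a = b ∧ 1 - b * a = 0) ∨ 1 - b * a = 2 := by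
  rcases ha with rfl | rfl <;> rcases hb with rfl | rfl <;> norm_num

theorem f16_near (τ s₁ s₂ s₃ s₄ a b c d e f : ℤ) (h0 : τ = 1 ∨ τ = -1) (h1 : s₁ = 1 ∨ s₁ = -1)
    (h2 : s₂ = 1 ∨ s₂ = -1) (h3 : s₃ = 1 ∨ s₃ = -1) (h4 : s₄ = 1 ∨ s₄ = -1)
    (ha : a = 1 ∨ a = -1) (hb : b = 1 ∨ b = -1)
    (hc : c = 1 ∨ c = -1) (hd : d = 1 ∨ d = -1) (he : e = 1 ∨ e = -1) (hf : f = 1 ∨ f = -1) :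
    f16 (fun k => (k : ℤ)) a b c d e f ≤ 8 - 8 * (s₁ * s₂ * (s₃ * s₄)) +
      8 * ((1 - τ * s₁ * s₂ * a) + (1 - τ * s₁ * s₃ * b) + (1 - τ * s₁ * s₄ * c) +
        (1 - τ * s₂ * s₃ * d) + (1 - τ * s₂ * s₄ * e) + (1 - τ * s₃ * s₄ * f)) := by
  have hv := (f16_values a b c d e f ha hb hc hd he hf).2.1
  have hp : s₁ * s₂ * (s₃ * s₄) ≤ 1 := by
    rcases pm_mul (pm_mul h1 h2) (pm_mul h3 h4) with h | h <;> rw [h] <;> norm_num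
  have g1 := pm_dev ha (pm_mul (pm_mul h0 h1) h2)
  have g2 := pm_dev hb (pm_mul (pm_mul h0 h1) h3)
  have g3 := pm_dev hc (pm_mul (pm_mul h0 h1) h4)
  have g4 := pm_dev hd (pm_mul (pm_mul h0 h2) h3)
  have g5 := pm_dev he (pm_mul (pm_mul h0 h2) h4)
  have g6 := pm_dev hf (pm_mul (pm_mul h0 h3) h4)
  by_cases hall : a = τ * s₁ * s₂ ∧ b = τ * s₁ * s₃ ∧ c = τ * s₁ * s₄ ∧ d = τ * s₂ * s₃ ∧
      e = τ * s₂ * s₄ ∧ f = τ * s₃ * s₄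
  · have hr := f16_rank_one τ s₁ s₂ s₃ s₄ h0 h1 h2 h3 h4
    obtain ⟨q1, q2, q3, q4, q5, q6⟩ := hall
    rw [← q1, ← q2, ← q3, ← q4, ← q5, ← q6] at hr
    rw [hr]
    omega
  · rcases g1 with ⟨q1, g1⟩ | g1
    · rcases g2 with ⟨q2, g2⟩ | g2
      · rcases g3 with ⟨q3, g3⟩ | g3
        · rcases g4 with ⟨q4, g4⟩ | g4
          · rcases g5 with ⟨q5, g5⟩ | g5
            · rcases g6 with ⟨q6, g6⟩ | g6
              · exact absurd ⟨q1, q2, q3, q4, q5, q6⟩ hall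
              · omega
            · omega
          · omega
        · omega
      · omega
    · omega

section struct
variable {V : Type} [Fintype V]

/-- Deviation of `X` from the rank one matrix `τ s sᵀ`. -/
def devS (X : V → V → ℤ) (τ : ℤ) (s : V → ℤ) : ℤ := ∑ u, ∑ z, (1 - τ * s u * s z * X u z)

theorem C4_sum_bound (X : V → V → ℤ) (hx : ∀ i j, X i j = 1 ∨ X i j = -1)
    (hs : ∀ i j, X i j = X j i) :
    3 * (∑ t : V × V, ∑ p : V × V, C4d X t.1 t.2 p.1 p.2)^2 ≤
      (Fintype.card V : ℤ)^2 * (1280 * (Fintype.card V : ℤ)^6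
        - 160 * (Fintype.card V : ℤ)^2 * F16 X) := by
  have h := main_ineq X hx hs
  have hc := sq_sum_le_card_mul_sum_sq (s := (Finset.univ : Finset (V × V)))
    (f := fun t => ∑ p : V × V, C4d X t.1 t.2 p.1 p.2)
  rw [Finset.card_univ, Fintype.card_prod] at hc
  push_cast at hc
  have hn : (0:ℤ) ≤ (Fintype.card V : ℤ)^2 := by positivity
  nlinarith [mul_le_mul_of_nonneg_left h hn]

theorem F16_near (X : V → V → ℤ) (hx : ∀ i j, X i j = 1 ∨ X i j = -1)
    (τ : ℤ) (s : V → ℤ) (hτ : τ = 1 ∨ τ = -1) (hs : ∀ u, s u = 1 ∨ s u = -1) :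
    F16 X + 8 * (∑ u, s u)^4 ≤ 8 * (Fintype.card V : ℤ)^4 +
      48 * (Fintype.card V : ℤ)^2 * devS X τ s := by
  have h : F16 X ≤ ∑ p : V × V, ∑ q : V × V, (8 - 8 * (s p.1 * s p.2 * (s q.1 * s q.2)) +
      8 * ((1 - τ * s p.1 * s p.2 * X p.1 p.2) + (1 - τ * s p.1 * s q.1 * X p.1 q.1)
        + (1 - τ * s p.1 * s q.2 * X p.1 q.2) +
        (1 - τ * s p.2 * s q.1 * X p.2 q.1) + (1 - τ * s p.2 * s q.2 * X p.2 q.2)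
        + (1 - τ * s q.1 * s q.2 * X q.1 q.2))) := by
    apply Finset.sum_le_sum
    intro p _
    apply Finset.sum_le_sum
    intro q _
    exact f16_near _ _ _ _ _ _ _ _ _ _ _ hτ (hs _) (hs _) (hs _) (hs _) (hx _ _) (hx _ _)
      (hx _ _) (hx _ _) (hx _ _) (hx _ _)
  have e : ∑ p : V × V, ∑ q : V × V, (8 - 8 * (s p.1 * s p.2 * (s q.1 * s q.2)) +
      8 * ((1 - τ * s p.1 * s p.2 * X p.1 p.2) + (1 - τ * s p.1 * s q.1 * X p.1 q.1)
        + (1 - τ * s p.1 * s q.2 * X p.1 q.2) +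
        (1 - τ * s p.2 * s q.1 * X p.2 q.1) + (1 - τ * s p.2 * s q.2 * X p.2 q.2)
        + (1 - τ * s q.1 * s q.2 * X q.1 q.2))) =
      8 * (Fintype.card V : ℤ)^4 - 8 * (∑ u, s u)^4 +
      48 * (Fintype.card V : ℤ)^2 * devS X τ s := by
    let D : V → V → ℤ := fun u z => 1 - τ * s u * s z * X u z
    have hD : ∀ u z, 1 - τ * s u * s z * X u z = D u z := fun _ _ => rfl
    have hdev : ∑ u, ∑ z, D u z = devS X τ s := rfl
    simp only [hD]
    simp only [Fintype.sum_prod_type, Finset.sum_add_distrib, Finset.sum_sub_distrib,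
      ← Finset.mul_sum, ← Finset.sum_mul, Finset.sum_const, Finset.card_univ, nsmul_eq_mul, hdev,
      Fintype.card_prod, Nat.cast_mul]
    ring
  rw [e] at h
  linarith

theorem rank_one (hV : 0 < Fintype.card V) (X : V → V → ℤ) (hx : ∀ i j, X i j = 1 ∨ X i j = -1)
    (hs : ∀ i j, X i j = X j i) :
    ∃ (τ : ℤ) (s : V → ℤ), (τ = 1 ∨ τ = -1) ∧ (∀ u, s u = 1 ∨ s u = -1) ∧
      (Fintype.card V : ℤ)^2 * devS X τ s ≤
        3 * ∑ t : V × V, ∑ p : V × V, C4d X t.1 t.2 p.1 p.2 := by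
  set n : ℤ := (Fintype.card V : ℤ) with hn
  have hnpos : 0 < n := by rw [hn]; exact_mod_cast hV
  set B := ∑ t : V × V, ∑ p : V × V, C4d X t.1 t.2 p.1 p.2 with hB
  have : Nonempty V := Fintype.card_pos_iff.1 hV
  have hB2 : B = ∑ r : V × V, ∑ u, ∑ z, C4d X u r.1 r.2 z := by
    rw [hB]
    simp only [Fintype.sum_prod_type]
    rw [Finset.sum_comm]
    apply Finset.sum_congr rfl
    intro v _
    rw [Finset.sum_comm]
  obtain ⟨r, -, hr⟩ : ∃ r ∈ (Finset.univ : Finset (V × V)),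
      n^2 * (∑ u, ∑ z, C4d X u r.1 r.2 z) ≤ B := by
    by_contra hcon
    push Not at hcon
    have h1 : ∑ r : V × V, B < ∑ r : V × V, n^2 * (∑ u, ∑ z, C4d X u r.1 r.2 z) :=
      Finset.sum_lt_sum_of_nonempty Finset.univ_nonempty hcon
    rw [← Finset.mul_sum, ← hB2, Finset.sum_const, Finset.card_univ, Fintype.card_prod,
      nsmul_eq_mul] at h1
    push_cast at h1
    rw [← hn] at h1
    nlinarith
  obtain ⟨v, w⟩ := r
  simp only at hr
  let y : V → ℤ := fun u => X u w * X v w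
  let β : V → ℤ := fun z => X v z
  have hy : ∀ u, y u = 1 ∨ y u = -1 := fun u => pm_mul (hx _ _) (hx _ _)
  have hβ : ∀ u, β u = 1 ∨ β u = -1 := fun u => hx _ _
  set K := ∑ u, ∑ z, C4d X u v w z with hK
  have hK1 : K = ∑ u, ∑ z, (1 - y u * β z * X u z) := by
    rw [hK]
    refine Finset.sum_congr rfl (fun u _ => Finset.sum_congr rfl (fun z _ => ?_))
    simp only [C4d, y, β]; ring
  have hK2 : K = ∑ u, ∑ z, (1 - y z * β u * X u z) := by
    rw [hK1, Finset.sum_comm]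
    refine Finset.sum_congr rfl (fun u _ => Finset.sum_congr rfl (fun z _ => ?_))
    rw [hs z u]
  let t : V → ℤ := fun u => y u * β u
  have ht : ∀ u, t u = 1 ∨ t u = -1 := fun u => pm_mul (hy _) (hβ _)
  have tri : ∀ a b : ℤ, (a = 1 ∨ a = -1) → (b = 1 ∨ b = -1) → 1 - a * b ≤ (1 - a) + (1 - b) := by
    intro a b ha hb
    rcases ha with rfl | rfl <;> rcases hb with rfl | rfl <;> norm_num
  have sq1 : ∀ a : ℤ, (a = 1 ∨ a = -1) → a * a = 1 := by
    intro a ha; rcases ha with rfl | rfl <;> norm_num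
  have h1 : ∑ u, ∑ z, (1 - t u * t z) ≤ 2 * K := by
    have : ∑ u, ∑ z, (1 - t u * t z) ≤
        ∑ u, ∑ z, ((1 - y u * β z * X u z) + (1 - y z * β u * X u z)) := by
      refine Finset.sum_le_sum (fun u _ => Finset.sum_le_sum (fun z _ => ?_))
      refine le_trans (le_of_eq ?_) (tri _ _ (pm_mul (pm_mul (hy u) (hβ z)) (hx u z))
        (pm_mul (pm_mul (hy z) (hβ u)) (hx u z)))
      simp only [t]
      linear_combination (y u * β u * y z * β z) * (sq1 _ (hx u z))
    simp only [Finset.sum_add_distrib] at this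
    linarith [hK1, hK2]
  set T := ∑ u, t u with hT
  have h2 : n * n - T * T ≤ 2 * K := by
    have : ∑ u, ∑ z, (1 - t u * t z) = n * n - T * T := by
      simp only [Finset.sum_sub_distrib, ← Finset.mul_sum, ← Finset.sum_mul, Finset.sum_const,
        Finset.card_univ, nsmul_eq_mul]
      rw [← hn, ← hT]; ring
    linarith
  have hTle : |T| ≤ n := by
    calc |T| ≤ ∑ u, |t u| := Finset.abs_sum_le_sum_abs _ _
      _ = ∑ u : V, (1 : ℤ) := by
        refine Finset.sum_congr rfl (fun u _ => ?_)
        rcases ht u with h | h <;> rw [h] <;> norm_num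
      _ = n := by simp [hn]
  obtain ⟨τ, hτ, hτT⟩ : ∃ τ : ℤ, (τ = 1 ∨ τ = -1) ∧ τ * T = |T| := by
    rcases le_total 0 T with h | h
    · exact ⟨1, Or.inl rfl, by rw [abs_of_nonneg h]; ring⟩
    · exact ⟨-1, Or.inr rfl, by rw [abs_of_nonpos h]; ring⟩
  have h3 : n * (n - τ * T) ≤ 2 * K := by
    have h0 : 0 ≤ |T| := abs_nonneg T
    have : T * T = |T| * |T| := (abs_mul_abs_self T).symm
    rw [hτT]
    nlinarith
  have h4 : devS X τ β ≤ 3 * K := by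
    have : devS X τ β ≤ ∑ u, ∑ z, ((1 - y u * β z * X u z) + (1 - τ * t u)) := by
      refine Finset.sum_le_sum (fun u _ => Finset.sum_le_sum (fun z _ => ?_))
      refine le_trans (le_of_eq ?_) (tri _ _ (pm_mul (pm_mul (hy u) (hβ z)) (hx u z))
        (pm_mul hτ (ht u)))
      simp only [t]
      linear_combination (τ * β u * β z * X u z) * (sq1 _ (hy u))
    simp only [Finset.sum_add_distrib] at this
    rw [← hK1] at this
    have e : ∑ u : V, ∑ z : V, (1 - τ * t u) = n * (n - τ * T) := by
      simp only [Finset.sum_const, Finset.card_univ, nsmul_eq_mul, ← Finset.mul_sum,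
        Finset.sum_sub_distrib]
      rw [← hn, ← hT]; ring
    linarith
  refine ⟨τ, β, hτ, hβ, ?_⟩
  have : (0 : ℤ) ≤ n^2 := by positivity
  nlinarith [mul_le_mul_of_nonneg_left h4 this]

end struct

section final
variable {n : ℕ}

/-- sign matrix of a graph -/
noncomputable def sgn (G : SimpleGraph (Fin n)) (u v : Fin n) : ℤ := if G.Adj u v then 1 else -1

theorem sgn_pm (G : SimpleGraph (Fin n)) (u v : Fin n) : sgn G u v = 1 ∨ sgn G u v = -1 := by
  unfold sgn; split <;> simp

theorem sgn_symm (G : SimpleGraph (Fin n)) (u v : Fin n) : sgn G u v = sgn G v u := by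
  unfold sgn; simp only [G.adj_comm]

theorem two_edgeCount (G : SimpleGraph (Fin n)) (S : Finset (Fin n)) :
    2 * edgeCount G S = ∑ u ∈ S, ∑ v ∈ S, if G.Adj u v then 1 else 0 := by
  have h1 : ∑ u ∈ S, ∑ v ∈ S, (if G.Adj u v then 1 else 0) =
      ((S ×ˢ S).filter (fun p => G.Adj p.1 p.2)).card := by
    rw [← Finset.sum_product', Finset.card_filter]
  have h2 : ((S ×ˢ S).filter (fun p => G.Adj p.1 p.2)) =
      ((Finset.univ : Finset (Fin n × Fin n)).filter
        (fun p => p.1 ∈ S ∧ p.2 ∈ S ∧ p.1 < p.2 ∧ G.Adj p.1 p.2)) ∪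
      ((Finset.univ : Finset (Fin n × Fin n)).filter
        (fun p => p.1 ∈ S ∧ p.2 ∈ S ∧ p.2 < p.1 ∧ G.Adj p.1 p.2)) := by
    ext p
    simp only [Finset.mem_filter, Finset.mem_product, Finset.mem_union, Finset.mem_univ, true_and]
    constructor
    · rintro ⟨⟨a, b⟩, c⟩
      rcases lt_or_gt_of_ne c.ne with h | h
      · exact Or.inl ⟨a, b, h, c⟩
      · exact Or.inr ⟨a, b, h, c⟩
    · rintro (⟨a, b, -, c⟩ | ⟨a, b, -, c⟩) <;> exact ⟨⟨a, b⟩, c⟩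
  have h3 : ((Finset.univ : Finset (Fin n × Fin n)).filter
        (fun p => p.1 ∈ S ∧ p.2 ∈ S ∧ p.2 < p.1 ∧ G.Adj p.1 p.2)).card = edgeCount G S := by
    unfold edgeCount
    refine Finset.card_bij (fun p _ => p.swap) ?_ ?_ ?_
    · intro p hp
      simp only [Finset.mem_filter, Finset.mem_univ, true_and, Prod.fst_swap, Prod.snd_swap] at hp ⊢
      exact ⟨hp.2.1, hp.1, hp.2.2.1, hp.2.2.2.symm⟩
    · intro p _ q _ h
      exact Prod.swap_injective h
    · intro p hp
      simp only [Finset.mem_filter, Finset.mem_univ, true_and] at hp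
      refine ⟨p.swap, ?_, by simp⟩
      simp only [Finset.mem_filter, Finset.mem_univ, true_and, Prod.fst_swap, Prod.snd_swap]
      exact ⟨hp.2.1, hp.1, hp.2.2.1, hp.2.2.2.symm⟩
  rw [h1, h2, Finset.card_union_of_disjoint, h3]
  · unfold edgeCount; ring
  · rw [Finset.disjoint_left]
    intro p hp hq
    simp only [Finset.mem_filter] at hp hq
    exact absurd hp.2.2.2.1 (not_lt.2 hq.2.2.2.1.le)

theorem edgeCount_four (G : SimpleGraph (Fin n)) (f : Fin 4 → Fin n) (hf : Function.Injective f)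
    (h : edgeCount G (Finset.univ.image f) = 3) :
    f16 (fun k => (k : ℤ)) (sgn G (f 0) (f 1)) (sgn G (f 0) (f 2)) (sgn G (f 0) (f 3))
      (sgn G (f 1) (f 2)) (sgn G (f 1) (f 3)) (sgn G (f 2) (f 3)) = 16 := by
  refine (f16_values _ _ _ _ _ _ (sgn_pm _ _ _) (sgn_pm _ _ _) (sgn_pm _ _ _) (sgn_pm _ _ _)
    (sgn_pm _ _ _) (sgn_pm _ _ _)).2.2 ?_
  have h2 := two_edgeCount G (Finset.univ.image f)
  rw [h, Finset.sum_image hf.injOn] at h2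
  simp only [Finset.sum_image hf.injOn, Fin.sum_univ_four, SimpleGraph.irrefl, if_false] at h2
  have hs : ∀ u v, sgn G u v = 2 * ((if G.Adj u v then 1 else 0 : ℕ) : ℤ) - 1 := by
    intro u v; unfold sgn; split <;> simp
  simp only [hs]
  have e : ∀ i j, (if G.Adj (f i) (f j) then 1 else 0 : ℕ) = if G.Adj (f j) (f i) then 1 else 0 := by
    intro i j; simp only [G.adj_comm]
  rw [e 1 0, e 2 0, e 3 0, e 2 1, e 3 1, e 3 2] at h2
  omega

theorem numKL_le (G : SimpleGraph (Fin n)) : 384 * (numKL 4 3 G : ℤ) ≤ F16 (sgn G) := by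
  let φ : (Fin n × Fin n) × (Fin n × Fin n) → (Fin 4 → Fin n) :=
    fun t => ![t.1.1, t.1.2, t.2.1, t.2.2]
  let F : (Fin n × Fin n) × (Fin n × Fin n) → ℤ := fun t =>
    f16 (fun k => (k : ℤ)) (sgn G t.1.1 t.1.2) (sgn G t.1.1 t.2.1) (sgn G t.1.1 t.2.2)
      (sgn G t.1.2 t.2.1) (sgn G t.1.2 t.2.2) (sgn G t.2.1 t.2.2)
  have hF0 : ∀ t, 0 ≤ F t := fun t => (f16_values _ _ _ _ _ _ (sgn_pm _ _ _) (sgn_pm _ _ _)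
    (sgn_pm _ _ _) (sgn_pm _ _ _) (sgn_pm _ _ _) (sgn_pm _ _ _)).1
  have hFs : F16 (sgn G) = ∑ t, F t := by
    rw [Fintype.sum_prod_type]; rfl
  set 𝒮 := (Finset.powersetCard 4 Finset.univ).filter (fun S => edgeCount G S = 3) with h𝒮
  let im : (Fin n × Fin n) × (Fin n × Fin n) → Finset (Fin n) := fun t => Finset.univ.image (φ t)
  have hfib : ∑ S ∈ 𝒮, ∑ t ∈ Finset.univ.filter (fun t => im t = S), F t ≤ ∑ t, F t := by
    have := Finset.sum_fiberwise_of_maps_to (s := Finset.univ.filter (fun t => im t ∈ 𝒮)) (t := 𝒮)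
      (g := im) (fun t ht => (Finset.mem_filter.1 ht).2) F
    calc _ = ∑ S ∈ 𝒮, ∑ t ∈ (Finset.univ.filter (fun t => im t ∈ 𝒮)).filter (fun t => im t = S), F t := by
          refine Finset.sum_congr rfl (fun S hS => ?_)
          refine Finset.sum_congr ?_ (fun _ _ => rfl)
          ext t
          simp only [Finset.mem_filter, Finset.mem_univ, true_and]
          constructor
          · intro h; exact ⟨h ▸ hS, h⟩
          · exact fun h => h.2
      _ = ∑ t ∈ Finset.univ.filter (fun t => im t ∈ 𝒮), F t := this
      _ ≤ _ := Finset.sum_le_sum_of_subset_of_nonneg (Finset.filter_subset _ _)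
        (fun t _ _ => hF0 t)
  have hS : ∀ S ∈ 𝒮, (384 : ℤ) ≤ ∑ t ∈ Finset.univ.filter (fun t => im t = S), F t := by
    intro S hS
    rw [h𝒮, Finset.mem_filter, Finset.mem_powersetCard] at hS
    obtain ⟨⟨-, hcard⟩, hec⟩ := hS
    have hval : ∀ t ∈ Finset.univ.filter (fun t => im t = S), F t = 16 := by
      intro t ht
      have him : Finset.univ.image (φ t) = S := (Finset.mem_filter.1 ht).2
      have hinj : Function.Injective (φ t) := by
        have h7 : (Finset.univ.image (φ t)).card = (Finset.univ : Finset (Fin 4)).card := by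
          rw [him, hcard]; simp
        have h8 := Finset.card_image_iff.1 h7
        rw [Finset.coe_univ] at h8
        exact Set.injOn_univ.1 h8
      have := edgeCount_four G (φ t) hinj (by rw [him]; exact hec)
      exact this
    rw [Finset.sum_congr rfl hval, Finset.sum_const, nsmul_eq_mul]
    have hc : 24 ≤ (Finset.univ.filter (fun t => im t = S)).card := by
      let e : Fin 4 ≃ S := (Finset.equivFinOfCardEq hcard).symm
      let ψ : Equiv.Perm (Fin 4) → (Fin n × Fin n) × (Fin n × Fin n) := fun σ =>
        (((e (σ 0)).1, (e (σ 1)).1), ((e (σ 2)).1, (e (σ 3)).1))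
      have hφ : ∀ σ, φ (ψ σ) = fun i => (e (σ i)).1 := by
        intro σ; funext i; fin_cases i <;> rfl
      have hψ : Function.Injective ψ := by
        intro σ σ' h
        have h2 : φ (ψ σ) = φ (ψ σ') := by rw [h]
        rw [hφ, hφ] at h2
        ext i
        have := congrFun h2 i
        have := e.injective (Subtype.ext this)
        rw [this]
      have : (Finset.univ.image ψ).card = 24 := by
        rw [Finset.card_image_of_injective _ hψ, Finset.card_univ, Fintype.card_perm]; rfl
      rw [← this]
      apply Finset.card_le_card
      intro t ht
      obtain ⟨σ, -, rfl⟩ := Finset.mem_image.1 ht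
      simp only [Finset.mem_filter, Finset.mem_univ, true_and, im, hφ]
      ext v
      simp only [Finset.mem_image, Finset.mem_univ, true_and]
      constructor
      · rintro ⟨i, rfl⟩; exact (e (σ i)).2
      · intro hv
        exact ⟨σ.symm (e.symm ⟨v, hv⟩), by simp⟩
    have : (24 : ℤ) ≤ ((Finset.univ.filter (fun t => im t = S)).card : ℤ) := by exact_mod_cast hc
    linarith
  have h5 := Finset.card_nsmul_le_sum 𝒮 (fun S => ∑ t ∈ Finset.univ.filter (fun t => im t = S), F t)
    384 hS
  rw [nsmul_eq_mul] at h5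
  have h6 : (numKL 4 3 G : ℤ) = (𝒮.card : ℤ) := rfl
  rw [hFs, h6]
  linarith

theorem exists_half (A : Finset (Fin n)) : ∃ A' : Finset (Fin n), A'.card = n / 2 ∧
    ((A \ A').card + (A' \ A).card : ℤ) = |(A.card : ℤ) - ((n / 2 : ℕ) : ℤ)| := by
  rcases le_total A.card (n/2) with h | h
  · obtain ⟨B, hAB, -, hB⟩ := Finset.exists_subsuperset_card_eq (Finset.subset_univ A) h
      (by rw [Finset.card_univ, Fintype.card_fin]; omega)
    refine ⟨B, hB, ?_⟩
    rw [Finset.sdiff_eq_empty_iff_subset.2 hAB, Finset.cast_card_sdiff hAB, hB, abs_of_nonpos]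
    · simp
    · have : (A.card : ℤ) ≤ ((n/2 : ℕ) : ℤ) := by exact_mod_cast h
      linarith
  · obtain ⟨B, hBA, hB⟩ := Finset.exists_subset_card_eq h
    refine ⟨B, hB, ?_⟩
    rw [Finset.sdiff_eq_empty_iff_subset.2 hBA, Finset.cast_card_sdiff hBA, hB, abs_of_nonneg]
    · simp
    · have : ((n/2 : ℕ) : ℤ) ≤ (A.card : ℤ) := by exact_mod_cast h
      linarith

theorem exists_perm (A : Finset (Fin n)) (hA : A.card = n / 2) :
    ∃ σ : Equiv.Perm (Fin n), ∀ u, (σ u).val < n / 2 ↔ u ∈ A := by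
  have hc : Fintype.card {u // u ∈ A} = Fintype.card {u : Fin n // u.val < n / 2} := by
    rw [Fintype.card_coe, hA, Fintype.card_subtype]
    have : (Finset.univ.filter (fun u : Fin n => u.val < n/2)).card = n / 2 := by
      rw [Fin.card_filter_val_lt]; omega
    rw [this]
  let e := Fintype.equivOfCardEq hc
  refine ⟨e.extendSubtype, fun u => ?_⟩
  constructor
  · intro h
    by_contra hu
    exact e.extendSubtype_not_mem u hu h
  · intro h
    exact e.extendSubtype_mem u h

theorem edit_bound (G : SimpleGraph (Fin n)) (τ : ℤ) (s : Fin n → ℤ) (hτ : τ = 1 ∨ τ = -1)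
    (hs : ∀ u, s u = 1 ∨ s u = -1) (H : SimpleGraph (Fin n))
    (hH : ∀ u v, u ≠ v → (H.Adj u v ↔ (τ = 1 ↔ (u.val < n/2 ↔ v.val < n/2)))) :
    2 * (editDist G H : ℤ) ≤ devS (sgn G) τ s + 2 * n * (|∑ u, s u| + 1) := by
  let A : Finset (Fin n) := Finset.univ.filter (fun u => s u = 1)
  obtain ⟨A', hA', hd⟩ := exists_half A
  obtain ⟨σ, hσ⟩ := exists_perm A' hA'
  have hle : editDist G H ≤ (Finset.univ.filter (fun p : Fin n × Fin n =>
      p.1 < p.2 ∧ ¬ (G.Adj p.1 p.2 ↔ H.Adj (σ p.1) (σ p.2)))).card :=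
    ciInf_le (OrderBot.bddBelow _) σ
  set E := (A \ A') ∪ (A' \ A) with hE
  set M := (Finset.univ.filter (fun p : Fin n × Fin n => τ * s p.1 * s p.2 * sgn G p.1 p.2 = -1))
    with hM
  have hsub : (Finset.univ.filter (fun p : Fin n × Fin n =>
      p.1 < p.2 ∧ ¬ (G.Adj p.1 p.2 ↔ H.Adj (σ p.1) (σ p.2)))) ⊆
      M ∪ (E ×ˢ Finset.univ ∪ Finset.univ ×ˢ E) := by
    rintro ⟨u, v⟩ hp
    simp only [Finset.mem_filter, Finset.mem_univ, true_and] at hp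
    obtain ⟨hlt, hne⟩ := hp
    simp only [Finset.mem_union, Finset.mem_product, Finset.mem_univ, and_true, true_and]
    by_cases hu : u ∈ E
    · exact Or.inr (Or.inl hu)
    by_cases hv : v ∈ E
    · exact Or.inr (Or.inr hv)
    left
    have hE' : ∀ w, w ∉ E → (w ∈ A' ↔ s w = 1) := by
      intro w hw
      simp only [hE, Finset.mem_union, Finset.mem_sdiff, A, Finset.mem_filter, Finset.mem_univ,
        true_and] at hw
      tauto
    rw [hH _ _ (fun h => hlt.ne (σ.injective h)), hσ, hσ, hE' u hu, hE' v hv] at hne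
    simp only [hM, Finset.mem_filter, Finset.mem_univ, true_and]
    unfold sgn
    by_cases hadj : G.Adj u v <;> rcases hτ with rfl | rfl <;> rcases hs u with h1 | h1 <;>
      rcases hs v with h2 | h2 <;> simp [hadj, h1, h2] at hne ⊢
  have hMdev : 2 * (M.card : ℤ) = devS (sgn G) τ s := by
    unfold devS
    rw [← Fintype.sum_prod_type' (fun u z => 1 - τ * s u * s z * sgn G u z), hM,
      Finset.card_filter]
    push_cast
    rw [Finset.mul_sum]
    refine Finset.sum_congr rfl (fun p _ => ?_)
    rcases pm_mul (pm_mul (pm_mul hτ (hs p.1)) (hs p.2)) (sgn_pm G p.1 p.2) with h | h <;>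
      rw [h] <;> norm_num
  have hEc : E.card ≤ (A \ A').card + (A' \ A).card := Finset.card_union_le _ _
  have hcard := (hle.trans (Finset.card_le_card hsub)).trans (Finset.card_union_le _ _)
  have hcard2 : (E ×ˢ (Finset.univ : Finset (Fin n)) ∪ (Finset.univ : Finset (Fin n)) ×ˢ E).card
      ≤ 2 * (n * E.card) := by
    refine (Finset.card_union_le _ _).trans ?_
    rw [Finset.card_product, Finset.card_product, Finset.card_univ, Fintype.card_fin]
    apply le_of_eq; ring
  have hsum : ∑ u, s u = 2 * (A.card : ℤ) - n := by
    have : ∀ u, s u = 2 * (if s u = 1 then 1 else 0) - 1 := by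
      intro u; rcases hs u with h | h <;> rw [h] <;> norm_num
    rw [Finset.sum_congr rfl (fun u _ => this u), Finset.sum_sub_distrib, ← Finset.mul_sum]
    simp [A]
  have hE2 : 2 * (E.card : ℤ) ≤ |∑ u, s u| + 1 := by
    have h1 : (E.card : ℤ) ≤ |(A.card : ℤ) - ((n / 2 : ℕ) : ℤ)| := by
      rw [← hd]; exact_mod_cast hEc
    rw [hsum]
    have h2 : ((n / 2 : ℕ) : ℤ) = (n : ℤ) / 2 := by simp
    rw [h2] at h1
    rcases abs_cases ((A.card : ℤ) - (n : ℤ) / 2) with ⟨h3, _⟩ | ⟨h3, _⟩ <;>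
    rcases abs_cases (2 * (A.card : ℤ) - (n : ℤ)) with ⟨h4, _⟩ | ⟨h4, _⟩ <;>
      rw [h3] at h1 <;> rw [h4] <;> omega
  have hfin : (editDist G H : ℤ) ≤ M.card + 2 * (n * E.card) := by
    have := hcard.trans (Nat.add_le_add_left hcard2 _)
    exact_mod_cast this
  have hn0 : (0 : ℤ) ≤ n := by positivity
  nlinarith [mul_le_mul_of_nonneg_left hE2 hn0]

end final

theorem choose_bounds (n : ℕ) (hn : 4 ≤ n) :
    24 * (n.choose 4 : ℝ) ≤ (n : ℝ)^4 ∧ (n : ℝ)^4 - 6 * (n : ℝ)^3 ≤ 24 * (n.choose 4 : ℝ) := by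
  obtain ⟨m, rfl⟩ := Nat.exists_eq_add_of_le' hn
  have h := Nat.descFactorial_eq_factorial_mul_choose (m+4) 4
  have e : (m+4).descFactorial 4 = (m+4)*(m+3)*(m+2)*(m+1) := by
    simp [Nat.descFactorial]; ring
  have e2 : Nat.factorial 4 = 24 := rfl
  rw [e, e2] at h
  have h' : ((m:ℝ)+4)*(m+3)*(m+2)*(m+1) = 24 * ((m+4).choose 4 : ℝ) := by exact_mod_cast h
  rw [← h']
  have hm : (0:ℝ) ≤ m := by positivity
  push_cast
  constructor
  · have h1 : ((m:ℝ)+3)*(m+2)*(m+1) ≤ (m+4)*(m+4)*(m+4) := by gcongr <;> linarith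
    calc ((m:ℝ)+4)*(m+3)*(m+2)*(m+1) = (m+4) * ((m+3)*(m+2)*(m+1)) := by ring
      _ ≤ (m+4) * ((m+4)*(m+4)*(m+4)) := by gcongr
      _ = _ := by ring
  · nlinarith [mul_nonneg hm hm]

theorem arith_main (N L C F B S m δ η μ ed : ℝ) (hN : 1 ≤ N) (hδ : 0 < δ) (hη : 0 < η) (hμ : 0 < μ)
    (hδN : 3 ≤ δ * N)
    (ha : (1/2 - δ) * C ≤ L) (hb1 : 24 * C ≤ N^4) (hb2 : N^4 - 6 * N^3 ≤ 24 * C)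
    (hc : 384 * L ≤ F) (hd : 3 * B^2 ≤ N^2 * (1280 * N^6 - 160 * N^2 * F))
    (he : N^2 * S ≤ 3 * B) (hf : F + 8 * m^4 ≤ 8 * N^4 + 48 * N^2 * S)
    (hg : 2 * ed ≤ S + 2 * N * (|m| + 1))
    (h1 : 1800 * δ ≤ η^2) (h2 : 4 * δ + 18 * η ≤ μ^4) :
    ed ≤ 3/2 * η * N^2 + N * (μ * N + 1) := by
  have hN0 : 0 < N := by linarith
  have hN3 : 0 < N^3 := by positivity
  have hF : 8 * N^4 - 32 * δ * N^4 ≤ F := by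
    have q1 : 3 * N^3 ≤ δ * N^4 := by
      calc 3 * N^3 ≤ (δ * N) * N^3 := by gcongr
        _ = δ * N^4 := by ring
    have q2 : δ * (24 * C) ≤ δ * N^4 := by gcongr
    nlinarith
  have hB : B ≤ η * N^4 := by
    have q : B^2 ≤ (η * N^4)^2 := by
      have q1 : N^4 * (8 * N^4 - 32 * δ * N^4) ≤ N^4 * F := by gcongr
      have q2 : 1800 * δ * N^8 ≤ η^2 * N^8 := by gcongr
      have q3 : 0 ≤ δ * N^8 := by positivity
      nlinarith
    exact (le_abs_self B).trans (abs_le_of_sq_le_sq q (by positivity))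
  have hS : S ≤ 3 * η * N^2 := by
    have hN2 : 0 < N^2 := by positivity
    have : N^2 * S ≤ N^2 * (3 * η * N^2) := by nlinarith
    exact le_of_mul_le_mul_left this hN2
  have hm : |m| ≤ μ * N := by
    have q : m^4 ≤ (μ * N)^4 := by
      have q1 : N^2 * S ≤ N^2 * (3 * η * N^2) := by gcongr
      have q2 : (4 * δ + 18 * η) * N^4 ≤ μ^4 * N^4 := by gcongr
      nlinarith
    have q' : |m|^4 ≤ (μ * N)^4 := by
      have : |m|^4 = m^4 := by
        rw [← abs_pow]; exact abs_of_nonneg (by positivity)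
      rw [this]; exact q
    exact le_of_pow_le_pow_left₀ (by norm_num) (by positivity) q'
  have : N * (|m| + 1) ≤ N * (μ * N + 1) := by gcongr
  linarith

theorem lam43_stability :
    ∀ ε : ℝ, 0 < ε → ∃ δ : ℝ, 0 < δ ∧ ∃ n₀ : ℕ, ∀ n : ℕ, n₀ ≤ n →
      ∀ G : SimpleGraph (Fin n), 1/2 - δ ≤ lamKL 4 3 G →
        (editDist G (halfBipartite n) : ℝ) ≤ ε * (n.choose 2 : ℝ) ∨
        (editDist G (halfTwoCliques n) : ℝ) ≤ ε * (n.choose 2 : ℝ) := by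
  intro ε hε
  obtain ⟨μ, hμ⟩ : ∃ μ : ℝ, μ = ε / 16 := ⟨_, rfl⟩
  have hμ0 : 0 < μ := by rw [hμ]; positivity
  obtain ⟨η, hη⟩ : ∃ η : ℝ, η = min (ε / 24) (μ^4 / 36) := ⟨_, rfl⟩
  have hη0 : 0 < η := by rw [hη]; positivity
  obtain ⟨δ, hδ⟩ : ∃ δ : ℝ, δ = min (μ^4 / 8) (η^2 / 1800) := ⟨_, rfl⟩
  have hδ0 : 0 < δ := by rw [hδ]; positivity
  have hη1 : η ≤ ε / 24 := by rw [hη]; exact min_le_left _ _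
  have hη2 : η ≤ μ^4 / 36 := by rw [hη]; exact min_le_right _ _
  have hδ1 : δ ≤ μ^4 / 8 := by rw [hδ]; exact min_le_left _ _
  have hδ2 : δ ≤ η^2 / 1800 := by rw [hδ]; exact min_le_right _ _
  refine ⟨δ, hδ0, max 4 (max ⌈3 / δ⌉₊ ⌈16 / ε⌉₊), ?_⟩
  intro n hn G hG
  have hn4 : 4 ≤ n := (le_max_left _ _).trans hn
  have hnδ : 3 / δ ≤ n := Nat.ceil_le.1
    ((le_max_left _ _).trans ((le_max_right _ _).trans hn))
  have hnε : 16 / ε ≤ n := Nat.ceil_le.1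
    ((le_max_right _ _).trans ((le_max_right _ _).trans hn))
  have hN4 : (4:ℝ) ≤ n := by exact_mod_cast hn4
  have hδN : 3 ≤ δ * n := by rw [div_le_iff₀ hδ0] at hnδ; linarith
  have hεN : 16 ≤ ε * n := by rw [div_le_iff₀ hε] at hnε; linarith
  obtain ⟨hb1, hb2⟩ := choose_bounds n hn4
  have hCpos : (0:ℝ) < (n.choose 4 : ℝ) := by exact_mod_cast Nat.choose_pos hn4
  have ha : (1/2 - δ) * (n.choose 4 : ℝ) ≤ (numKL 4 3 G : ℝ) := by
    unfold lamKL at hG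
    rwa [le_div_iff₀ hCpos] at hG
  have hx := sgn_pm G
  have hs := sgn_symm G
  have hcard : Fintype.card (Fin n) = n := Fintype.card_fin n
  obtain ⟨τ, s, hτ, hsp, he⟩ := rank_one (by rw [hcard]; omega) (sgn G) hx hs
  have hd := C4_sum_bound (sgn G) hx hs
  have hf := F16_near (sgn G) hx τ s hτ hsp
  have hc := numKL_le G
  rw [hcard] at he hd hf
  generalize hBdef : ∑ t : Fin n × Fin n, ∑ p : Fin n × Fin n, C4d (sgn G) t.1 t.2 p.1 p.2 = B
    at he hd
  have hc' : 384 * (numKL 4 3 G : ℝ) ≤ (F16 (sgn G) : ℝ) := by exact_mod_cast hc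
  have hd' : 3 * (B:ℝ)^2 ≤ (n:ℝ)^2 * (1280 * (n:ℝ)^6 - 160 * (n:ℝ)^2 * (F16 (sgn G) : ℝ)) := by
    exact_mod_cast hd
  have he' : (n:ℝ)^2 * (devS (sgn G) τ s : ℝ) ≤ 3 * (B:ℝ) := by exact_mod_cast he
  have hf' : (F16 (sgn G) : ℝ) + 8 * ((∑ u, s u : ℤ) : ℝ)^4 ≤ 8 * (n:ℝ)^4 +
      48 * (n:ℝ)^2 * (devS (sgn G) τ s : ℝ) := by exact_mod_cast hf
  have hfinal : ∀ H : SimpleGraph (Fin n),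
      (∀ u v, u ≠ v → (H.Adj u v ↔ (τ = 1 ↔ (u.val < n/2 ↔ v.val < n/2)))) →
      (editDist G H : ℝ) ≤ ε * (n.choose 2 : ℝ) := by
    intro H hH
    have hg := edit_bound G τ s hτ hsp H hH
    have hg' : 2 * (editDist G H : ℝ) ≤ (devS (sgn G) τ s : ℝ) +
        2 * (n:ℝ) * (|((∑ u, s u : ℤ) : ℝ)| + 1) := by exact_mod_cast hg
    have := arith_main n (numKL 4 3 G) (n.choose 4) (F16 (sgn G)) B (devS (sgn G) τ s)
      ((∑ u, s u : ℤ) : ℝ) δ η μ (editDist G H) (by linarith) hδ0 hη0 hμ0 hδN ha hb1 hb2 hc' hd'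
      he' hf' hg' (by linarith) (by linarith)
    refine this.trans ?_
    rw [Nat.cast_choose_two]
    have q1 : η * (n:ℝ)^2 ≤ ε / 24 * (n:ℝ)^2 := by gcongr
    rw [hμ]
    have q2 : 16 * (n:ℝ) ≤ ε * (n:ℝ)^2 := by nlinarith
    have q3 : 4 * (ε * (n:ℝ)) ≤ ε * (n:ℝ)^2 := by nlinarith [mul_le_mul_of_nonneg_left hN4 hε.le]
    linarith
  rcases hτ with h | h
  · right
    apply hfinal
    intro u v huv
    simp only [halfTwoCliques, SimpleGraph.fromRel_adj, h]
    by_cases h1 : u.val < n / 2 <;> by_cases h2 : v.val < n / 2 <;> simp [h1, h2, huv]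
  · left
    apply hfinal
    intro u v huv
    simp only [halfBipartite, SimpleGraph.fromRel_adj, h]
    by_cases h1 : u.val < n / 2 <;> by_cases h2 : v.val < n / 2 <;> simp [h1, h2, huv]
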